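/- arXiv:1906.07881 — 6 statements merged into one kernel-verified Lean document; each statement's English description precedes it below -/
import Mathlib

section
/- (Comparison principle for the linear nonlocal equation.) Assume (H1). Let c≥0, let T∈(0,∞], and let a:ℝ→ℝ be bounded and continuous. Suppose v̲,v̄:[0,T)×ℝ→ℝ are continuous, have continuous partial derivatives ∂_t and ∂_ξ on [0,T)×ℝ, are bounded on [0,T']×ℝ for every T'<T, and satisfy for all (t,ξ)∈[0,T)×ℝ: ∂_t v̲(t,ξ) ≤ c ∂_ξ v̲(t,ξ)+∫_ℝ k(η−ξ) v̲(t,η) dη − v̲(t,ξ) + a(ξ) v̲(t,ξ), and ∂_t v̄(t,ξ) ≥ c ∂_ξ v̄(t,ξ)+∫_ℝ k(η−ξ) v̄(t,η) dη − v̄(t,ξ) + a(ξ) v̄(t,ξ). If v̲(0,ξ) ≤ v̄(0,ξ) for all ξ∈ℝ and there exists β₀>0 with v̄(t,ξ)−v̲(t,ξ) ≥ −β₀ for all (t,ξ)∈[0,T)×ℝ, then v̲(t,ξ) ≤ v̄(t,ξ) for all t∈[0,T) and all ξ∈ℝ. -/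
open MeasureTheory Real Set Filter Topology

noncomputable section

/-- Hypothesis (H1) on the kernel `k`. -/
def H1 (k : ℝ → ℝ) : Prop :=
  ContDiff ℝ 1 k ∧ (∀ z, 0 ≤ k z) ∧ (∀ z, k (-z) = k z) ∧
  (∫ z, k z) = 1 ∧ 0 < k 0 ∧
  ∃ μ M : ℝ, 0 < μ ∧ 0 < M ∧ ∀ z, M < |z| →
    k z < Real.exp (-(μ * |z|)) ∧ |deriv k z| < Real.exp (-(μ * |z|))

/-- Hypothesis (EXP): all exponential moments of `k` are finite. -/
def EXPk (k : ℝ → ℝ) : Prop :=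
  ∀ μ : ℝ, MeasureTheory.Integrable (fun z => Real.exp (μ * z) * k z)

/-- Hypothesis (H2) on the cut-off function `χ`. -/
def IsH2chi (r q L L0 : ℝ) (χ : ℝ → ℝ) : Prop :=
  0 < r ∧ 0 < q ∧ 0 < L ∧ 0 < L0 ∧
  ContDiff ℝ 1 χ ∧ (∀ x, χ x ∈ Set.Icc (0:ℝ) 1) ∧
  (∀ x, χ (-x) = χ x) ∧ (∀ x, |x| ≤ L → χ x = 1) ∧
  (∀ x, L + L0 ≤ |x| → χ x = 0) ∧ AntitoneOn χ (Set.Ici 0)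

/-- The growth function of hypothesis (H2). -/
def fH2 (r q : ℝ) (χ : ℝ → ℝ) : ℝ → ℝ → ℝ :=
  fun x u => -q + (r * (1 - u) + q) * χ x

/-- A bounded positive traveling-wave profile for speed `c`, kernel `k`, growth `f`. -/
def IsTW (c : ℝ) (k : ℝ → ℝ) (f : ℝ → ℝ → ℝ) (Φ : ℝ → ℝ) : Prop :=
  ContDiff ℝ 1 Φ ∧ (∀ ξ, 0 < Φ ξ) ∧ (∃ C, ∀ ξ, Φ ξ ≤ C) ∧
  ∀ ξ, c * deriv Φ ξ + ((∫ η, k (η - ξ) * Φ η) - Φ ξ) + f ξ (Φ ξ) * Φ ξ = 0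

/-- A bounded classical solution of equation (E) on `[0,∞) × ℝ`, with partial
derivatives `vt` (in time) and `vx` (in space). -/
def IsClassicalSol (c : ℝ) (k : ℝ → ℝ) (f : ℝ → ℝ → ℝ) (v vt vx : ℝ → ℝ → ℝ) : Prop :=
  (∃ C, ∀ t ξ, 0 ≤ t → |v t ξ| ≤ C) ∧
  ContinuousOn (fun p : ℝ × ℝ => v p.1 p.2) {p : ℝ × ℝ | 0 ≤ p.1} ∧
  ContinuousOn (fun p : ℝ × ℝ => vt p.1 p.2) {p : ℝ × ℝ | 0 ≤ p.1} ∧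
  ContinuousOn (fun p : ℝ × ℝ => vx p.1 p.2) {p : ℝ × ℝ | 0 ≤ p.1} ∧
  (∀ t ξ, 0 ≤ t → HasDerivWithinAt (fun s => v s ξ) (vt t ξ) (Set.Ici 0) t) ∧
  (∀ t ξ, 0 ≤ t → HasDerivAt (fun y => v t y) (vx t ξ) ξ) ∧
  (∀ t ξ, 0 ≤ t →
    vt t ξ = c * vx t ξ + ((∫ η, k (η - ξ) * v t η) - v t ξ) + f ξ (v t ξ) * v t ξ)

/-- The spreading speed `c*` of the homogeneous equation with growth rate `r`. -/
def cstar (k : ℝ → ℝ) (r : ℝ) : ℝ :=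
  sInf {y : ℝ | ∃ μ : ℝ, 0 < μ ∧ y = ((∫ z, Real.exp (-(μ * z)) * k z) - 1 + r) / μ}

lemma left_deriv_nonpos (f : ℝ → ℝ) (d t : ℝ) (ht : 0 < t)
    (h : HasDerivWithinAt f d (Set.Icc 0 t) t) (hm : ∀ s ∈ Set.Icc 0 t, f t ≤ f s) : d ≤ 0 := by
  have h1 : HasDerivWithinAt f d (Set.Ico 0 t) t := h.mono Set.Ico_subset_Icc_self
  rw [hasDerivWithinAt_iff_tendsto_slope' (by simp)] at h1
  have : (𝓝[Set.Ico 0 t] t).NeBot := by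
    rw [← mem_closure_iff_nhdsWithin_neBot, closure_Ico ht.ne]
    exact ⟨ht.le, le_rfl⟩
  refine le_of_tendsto h1 ?_
  filter_upwards [self_mem_nhdsWithin] with s hs
  rw [slope_def_field]
  have := hm s ⟨hs.1, hs.2.le⟩
  exact div_nonpos_of_nonneg_of_nonpos (by linarith) (by linarith [hs.2])

lemma conv_ge (k : ℝ → ℝ) (hk0 : ∀ z, 0 ≤ k z) (hki : Integrable k) (hk1 : ∫ z, k z = 1)
    (g : ℝ → ℝ) (hg : Continuous g) (C m : ℝ) (hC : ∀ x, |g x| ≤ C) (hm : ∀ x, m ≤ g x) (x : ℝ) :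
    m ≤ ∫ y, k (y - x) * g y := by
  have hi : Integrable (fun y => k (y - x)) := hki.comp_sub_right x
  have h1 : ∫ y, k (y - x) * m = m := by
    rw [integral_mul_const, integral_sub_right_eq_self (μ := volume) k x, hk1, one_mul]
  have hi2 : Integrable (fun y => k (y - x) * g y) :=
    hi.mul_bdd (c := C) hg.aestronglyMeasurable (ae_of_all _ hC)
  calc m = ∫ y, k (y - x) * m := h1.symm
    _ ≤ _ := integral_mono (hi.mul_const m) hi2
        (fun y => mul_le_mul_of_nonneg_left (hm y) (hk0 _))

lemma conv_int (k : ℝ → ℝ) (hki : Integrable k)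
    (g : ℝ → ℝ) (hg : Continuous g) (C : ℝ) (hC : ∀ x, |g x| ≤ C) (x : ℝ) :
    Integrable (fun y => k (y - x) * g y) :=
  (hki.comp_sub_right x).mul_bdd (c := C) hg.aestronglyMeasurable (ae_of_all _ hC)

lemma psi_deriv (x1 x : ℝ) : HasDerivAt (fun y : ℝ => 1 - (1 + (y - x1) ^ 2)⁻¹)
    (2 * (x - x1) / (1 + (x - x1) ^ 2) ^ 2) x := by
  have h0 : (1 + (x - x1) ^ 2) ≠ 0 := by positivity
  have h := ((((hasDerivAt_id x).sub_const x1).pow 2).const_add 1).inv (by simpa using h0)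
  have h2 := h.const_sub 1
  refine h2.congr_deriv ?_
  simp
  ring

lemma core1 (k : ℝ → ℝ) (hk0 : ∀ z, 0 ≤ k z) (hki : Integrable k) (hk1 : ∫ z, k z = 1)
    (c : ℝ) (hc : 0 ≤ c) (S B : ℝ) (b : ℝ → ℝ) (hb : ∀ x, b x ≤ -1) (hB : ∀ x, -B ≤ b x)
    (W Wt Wx : ℝ → ℝ → ℝ) (C : ℝ)
    (hC : ∀ t x, 0 ≤ t → t ≤ S → |W t x| ≤ C)
    (hcont : ContinuousOn (fun p : ℝ × ℝ => W p.1 p.2) (Set.Icc 0 S ×ˢ Set.univ))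
    (ht : ∀ t x, 0 ≤ t → t ≤ S → HasDerivWithinAt (fun s => W s x) (Wt t x) (Set.Icc 0 S) t)
    (hx : ∀ t x, 0 ≤ t → t ≤ S → HasDerivAt (fun y => W t y) (Wx t x) x)
    (hW : ∀ t x, 0 ≤ t → t ≤ S →
      c * Wx t x + ((∫ y, k (y - x) * W t y) - W t x) + b x * W t x ≤ Wt t x)
    (h0 : ∀ x, 0 ≤ W 0 x) : ∀ t x, 0 ≤ t → t ≤ S → 0 ≤ W t x := by
  intro t2 x2 ht2 ht2S
  by_contra! hneg
  set V : Set ℝ := (fun p : ℝ × ℝ => W p.1 p.2) '' (Set.Icc 0 S ×ˢ Set.univ) with hV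
  have hbdd : BddBelow V := by
    refine ⟨-C, ?_⟩
    rintro _ ⟨p, hp, rfl⟩
    exact (abs_le.1 (hC p.1 p.2 hp.1.1 hp.1.2)).1
  have hmemV : ∀ t x, 0 ≤ t → t ≤ S → W t x ∈ V := fun t x h h' => ⟨(t, x), ⟨⟨h, h'⟩, trivial⟩, rfl⟩
  set m := sInf V with hm
  have hmle : ∀ t x, 0 ≤ t → t ≤ S → m ≤ W t x := fun t x h h' => csInf_le hbdd (hmemV t x h h')
  have hm0 : m < 0 := (hmle t2 x2 ht2 ht2S).trans_lt hneg
  have hB1 : 1 ≤ B := by linarith [hb 0, hB 0]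
  obtain ⟨δ, hδ, hδ1⟩ : ∃ δ : ℝ, 0 < δ ∧ δ * (2 * c + B + 2) = -m := by
    have : 0 < 2 * c + B + 2 := by linarith
    exact ⟨-m / (2 * c + B + 2), div_pos (by linarith) this, div_mul_cancel₀ _ this.ne'⟩
  have hδm : m + δ < 0 := by nlinarith
  obtain ⟨_, ⟨⟨t1, x1⟩, ⟨⟨ht1, ht1S⟩, -⟩, rfl⟩, hlt⟩ :=
    exists_lt_of_csInf_lt (⟨_, hmemV t2 x2 ht2 ht2S⟩ : V.Nonempty) (show sInf V < m + δ by linarith)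
  simp only at hlt ht1 ht1S
  set ψ : ℝ → ℝ := fun y => 1 - (1 + (y - x1) ^ 2)⁻¹ with hψ
  have hψ0 : ∀ y, 0 ≤ ψ y := by
    intro y
    have : (1 + (y - x1) ^ 2)⁻¹ ≤ 1 := inv_le_one_of_one_le₀ (by nlinarith [sq_nonneg (y - x1)])
    simp only [hψ]; linarith
  have hψ1 : ψ x1 = 0 := by simp [hψ]
  have hψd : ∀ y, HasDerivAt ψ (2 * (y - x1) / (1 + (y - x1) ^ 2) ^ 2) y := psi_deriv x1
  have hψc : Continuous ψ := continuous_iff_continuousAt.2 fun y => (hψd y).continuousAt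
  have hcompact : IsCompact (Set.Icc 0 S ×ˢ Set.Icc (x1 - 1) (x1 + 1)) :=
    isCompact_Icc.prod isCompact_Icc
  have hne1 : (t1, x1) ∈ Set.Icc 0 S ×ˢ Set.Icc (x1 - 1) (x1 + 1) :=
    ⟨⟨ht1, ht1S⟩, by simp⟩
  obtain ⟨⟨t0, x0⟩, ⟨⟨ht0, ht0S⟩, hx0⟩, hmin⟩ := hcompact.exists_isMinOn ⟨_, hne1⟩
    (f := fun p : ℝ × ℝ => W p.1 p.2 + 2 * δ * ψ p.2)
    ((hcont.mono (Set.prod_mono le_rfl (Set.subset_univ _))).add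
      (by fun_prop))
  simp only at ht0 ht0S hx0
  have hu1 : W t0 x0 + 2 * δ * ψ x0 ≤ W t1 x1 := by
    have := hmin hne1
    simpa [hψ1] using this
  have hglob : ∀ t x, 0 ≤ t → t ≤ S → W t0 x0 + 2 * δ * ψ x0 ≤ W t x + 2 * δ * ψ x := by
    intro t x h h'
    by_cases hxx : x ∈ Set.Icc (x1 - 1) (x1 + 1)
    · exact hmin (show (t, x) ∈ _ from ⟨⟨h, h'⟩, hxx⟩)
    · have h1 : 1 ≤ (x - x1) ^ 2 := by
        by_contra! hh
        rw [sq_lt_one_iff_abs_lt_one, abs_lt] at hh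
        exact hxx ⟨by linarith, by linarith⟩
      have h2 : (1 + (x - x1) ^ 2)⁻¹ ≤ 2⁻¹ := inv_anti₀ (by norm_num) (by linarith)
      have h3 : 1 / 2 ≤ ψ x := by simp only [hψ]; linarith
      have := hmle t x h h'
      nlinarith
  have hW0 : W t0 x0 < m + δ := by
    have : 0 ≤ 2 * δ * ψ x0 := mul_nonneg (by linarith) (hψ0 _)
    linarith
  have ht0' : 0 < t0 := by
    rcases ht0.lt_or_eq with h | h
    · exact h
    · rw [← h] at hW0
      linarith [h0 x0]
  have hWt : Wt t0 x0 ≤ 0 := by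
    refine left_deriv_nonpos (fun s => W s x0) _ t0 ht0'
      ((ht t0 x0 ht0 ht0S).mono (Set.Icc_subset_Icc_right ht0S)) ?_
    intro s hs
    have := hglob s x0 hs.1 (hs.2.trans ht0S)
    try simp only
    linarith
  have hWx : Wx t0 x0 + 2 * δ * (2 * (x0 - x1) / (1 + (x0 - x1) ^ 2) ^ 2) = 0 := by
    have hd := (hx t0 x0 ht0 ht0S).add ((hψd x0).const_mul (2 * δ))
    refine IsLocalMin.hasDerivAt_eq_zero (Filter.Eventually.of_forall fun y => ?_) hd
    exact hglob t0 y ht0 ht0S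
  have hψ' : 2 * (x0 - x1) / (1 + (x0 - x1) ^ 2) ^ 2 ≤ 1 := by
    rw [div_le_one (by positivity)]
    nlinarith [sq_nonneg (x0 - x1 - 1), sq_nonneg ((x0 - x1) ^ 2)]
  have hconv : m ≤ ∫ y, k (y - x0) * W t0 y :=
    conv_ge k hk0 hki hk1 (W t0)
      (continuous_iff_continuousAt.2 fun y => (hx t0 y ht0 ht0S).continuousAt) C m
      (fun x => hC t0 x ht0 ht0S) (fun x => hmle t0 x ht0 ht0S) x0
  have hmain := hW t0 x0 ht0 ht0S
  have hcx : -(2 * δ * c) ≤ c * Wx t0 x0 := by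
    have : -(2 * δ) ≤ Wx t0 x0 := by nlinarith
    nlinarith
  have h5 : (1 - b x0) * W t0 x0 ≤ (1 - b x0) * (m + δ) :=
    mul_le_mul_of_nonneg_left hW0.le (by linarith [hb x0])
  have h6 : (1 - b x0) * m ≤ 2 * m := by nlinarith [hb x0]
  have h7 : (1 - b x0) * δ ≤ (1 + B) * δ := by nlinarith [hB x0]
  nlinarith

/-- Comparison principle for the linear nonlocal equation on `[0,T) × ℝ`,
where `T ∈ (0,∞]` is modeled as an extended real number. -/
theorem comparison_principle_linear
    (k : ℝ → ℝ) (hk : H1 k) (c : ℝ) (hc : 0 ≤ c)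
    (T : EReal) (hT : 0 < T)
    (a : ℝ → ℝ) (haC : Continuous a) (haB : ∃ C, ∀ ξ, |a ξ| ≤ C)
    (vl vlt vlx vu vut vux : ℝ → ℝ → ℝ)
    (hvlC : ContinuousOn (fun p : ℝ × ℝ => vl p.1 p.2)
      {p : ℝ × ℝ | 0 ≤ p.1 ∧ (p.1 : EReal) < T})
    (hvltC : ContinuousOn (fun p : ℝ × ℝ => vlt p.1 p.2)
      {p : ℝ × ℝ | 0 ≤ p.1 ∧ (p.1 : EReal) < T})
    (hvlxC : ContinuousOn (fun p : ℝ × ℝ => vlx p.1 p.2)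
      {p : ℝ × ℝ | 0 ≤ p.1 ∧ (p.1 : EReal) < T})
    (hvuC : ContinuousOn (fun p : ℝ × ℝ => vu p.1 p.2)
      {p : ℝ × ℝ | 0 ≤ p.1 ∧ (p.1 : EReal) < T})
    (hvutC : ContinuousOn (fun p : ℝ × ℝ => vut p.1 p.2)
      {p : ℝ × ℝ | 0 ≤ p.1 ∧ (p.1 : EReal) < T})
    (hvuxC : ContinuousOn (fun p : ℝ × ℝ => vux p.1 p.2)
      {p : ℝ × ℝ | 0 ≤ p.1 ∧ (p.1 : EReal) < T})
    (hvlder_t : ∀ (t : ℝ) (ξ : ℝ), 0 ≤ t → (t : EReal) < T →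
      HasDerivWithinAt (fun s => vl s ξ) (vlt t ξ) {s : ℝ | 0 ≤ s ∧ (s : EReal) < T} t)
    (hvlder_x : ∀ (t : ℝ) (ξ : ℝ), 0 ≤ t → (t : EReal) < T →
      HasDerivAt (fun y => vl t y) (vlx t ξ) ξ)
    (hvuder_t : ∀ (t : ℝ) (ξ : ℝ), 0 ≤ t → (t : EReal) < T →
      HasDerivWithinAt (fun s => vu s ξ) (vut t ξ) {s : ℝ | 0 ≤ s ∧ (s : EReal) < T} t)
    (hvuder_x : ∀ (t : ℝ) (ξ : ℝ), 0 ≤ t → (t : EReal) < T →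
      HasDerivAt (fun y => vu t y) (vux t ξ) ξ)
    (hvlB : ∀ T' : ℝ, (T' : EReal) < T → ∃ C, ∀ t ξ, 0 ≤ t → t ≤ T' → |vl t ξ| ≤ C)
    (hvuB : ∀ T' : ℝ, (T' : EReal) < T → ∃ C, ∀ t ξ, 0 ≤ t → t ≤ T' → |vu t ξ| ≤ C)
    (hsub : ∀ (t : ℝ) (ξ : ℝ), 0 ≤ t → (t : EReal) < T →
      vlt t ξ ≤ c * vlx t ξ + ((∫ η, k (η - ξ) * vl t η) - vl t ξ) + a ξ * vl t ξ)
    (hsup : ∀ (t : ℝ) (ξ : ℝ), 0 ≤ t → (t : EReal) < T →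
      c * vux t ξ + ((∫ η, k (η - ξ) * vu t η) - vu t ξ) + a ξ * vu t ξ ≤ vut t ξ)
    (hinit : ∀ ξ, vl 0 ξ ≤ vu 0 ξ)
    (hβ : ∃ β₀ : ℝ, 0 < β₀ ∧ ∀ (t : ℝ) (ξ : ℝ), 0 ≤ t → (t : EReal) < T → -β₀ ≤ vu t ξ - vl t ξ) :
    ∀ (t : ℝ) (ξ : ℝ), 0 ≤ t → (t : EReal) < T → vl t ξ ≤ vu t ξ := by
  obtain ⟨hkC, hk0, -, hk1, -, -⟩ := hk
  have hki : Integrable k := by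
    by_contra h
    rw [integral_undef h] at hk1
    norm_num at hk1
  obtain ⟨A, hA⟩ := haB
  intro S x hS hST
  obtain ⟨C1, hC1⟩ := hvlB S hST
  obtain ⟨C2, hC2⟩ := hvuB S hST
  have hlt : ∀ t : ℝ, t ≤ S → (t : EReal) < T := fun t h =>
    lt_of_le_of_lt (EReal.coe_le_coe_iff.2 h) hST
  have hA0 : 0 ≤ A := (abs_nonneg _).trans (hA 0)
  have key := core1 k hk0 hki hk1 c hc S (2 * A + 1) (fun x => a x - (A + 1))
    (fun x => by linarith [(abs_le.1 (hA x)).2]) (fun x => by linarith [(abs_le.1 (hA x)).1])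
    (fun t x => Real.exp (-(A + 1) * t) * (vu t x - vl t x))
    (fun t x => Real.exp (-(A + 1) * t) * (vut t x - vlt t x - (A + 1) * (vu t x - vl t x)))
    (fun t x => Real.exp (-(A + 1) * t) * (vux t x - vlx t x)) (C2 + C1)
    ?_ ?_ ?_ ?_ ?_ ?_ S x hS le_rfl
  · have := nonneg_of_mul_nonneg_right key (Real.exp_pos _)
    linarith
  · intro t x h h'
    have h1 : |vu t x - vl t x| ≤ C2 + C1 :=
      (abs_sub _ _).trans (add_le_add (hC2 t x h h') (hC1 t x h h'))
    have h2 : Real.exp (-(A + 1) * t) ≤ 1 := by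
      rw [Real.exp_le_one_iff]; nlinarith
    rw [abs_mul, abs_of_pos (Real.exp_pos _)]
    calc _ ≤ 1 * |vu t x - vl t x| := mul_le_mul_of_nonneg_right h2 (abs_nonneg _)
      _ ≤ _ := by linarith
  · have hs : (Set.Icc 0 S ×ˢ Set.univ : Set (ℝ × ℝ)) ⊆
        {p : ℝ × ℝ | 0 ≤ p.1 ∧ (p.1 : EReal) < T} := fun p hp => ⟨hp.1.1, hlt _ hp.1.2⟩
    exact ContinuousOn.mul (by fun_prop) ((hvuC.mono hs).sub (hvlC.mono hs))
  · intro t x h h'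
    have hs : Set.Icc 0 S ⊆ {s : ℝ | 0 ≤ s ∧ (s : EReal) < T} := fun p hp => ⟨hp.1, hlt _ hp.2⟩
    have d1 := ((hvuder_t t x h (hlt t h')).mono hs).sub ((hvlder_t t x h (hlt t h')).mono hs)
    have d2 : HasDerivAt (fun s : ℝ => Real.exp (-(A + 1) * s))
        (Real.exp (-(A + 1) * t) * (-(A + 1) * 1)) t :=
      ((hasDerivAt_id t).const_mul (-(A + 1))).exp
    refine (d2.hasDerivWithinAt.mul d1).congr_deriv ?_
    simp only [Pi.sub_apply]
    ring
  · intro t x h h'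
    exact ((hvuder_x t x h (hlt t h')).sub (hvlder_x t x h (hlt t h'))).const_mul _
  · intro t x h h'
    have hcu : Continuous (vu t) :=
      continuous_iff_continuousAt.2 fun y => (hvuder_x t y h (hlt t h')).continuousAt
    have hcl : Continuous (vl t) :=
      continuous_iff_continuousAt.2 fun y => (hvlder_x t y h (hlt t h')).continuousAt
    have e1 : ∫ y, k (y - x) * (Real.exp (-(A + 1) * t) * (vu t y - vl t y)) =
        Real.exp (-(A + 1) * t) * ((∫ y, k (y - x) * vu t y) - ∫ y, k (y - x) * vl t y) := by
      rw [← integral_sub (conv_int k hki _ hcu C2 (fun y => hC2 t y h h') x)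
        (conv_int k hki _ hcl C1 (fun y => hC1 t y h h') x), ← integral_const_mul]
      congr 1
      ext y
      ring
    try simp only
    rw [e1]
    have i1 := hsub t x h (hlt t h')
    have i2 := hsup t x h (hlt t h')
    have := mul_le_mul_of_nonneg_left (add_le_add i1 i2) (Real.exp_pos (-(A + 1) * t)).le
    linarith
  · intro x
    exact mul_nonneg (Real.exp_pos _).le (by linarith [hinit x])
end
end

section
/- (Strong comparison principle for the nonlinear nonlocal equation.) Assume (H1) and (H2), and let c≥0. Let v₁ and v₂ be bounded classical solutions of (E) on [0,∞) such that v₁(0,ξ) ≤ v₂(0,ξ) for all ξ∈ℝ and v₁(0,·) is not identically equal to v₂(0,·). Then v₁(t,ξ) < v₂(t,ξ) for all t>0 and all ξ∈ℝ. -/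
open MeasureTheory Real Set Filter Topology

noncomputable section

lemma chain_aux (c : ℝ) (v vt vx : ℝ → ℝ → ℝ)
    (h2 : ContinuousOn (fun p : ℝ × ℝ => vt p.1 p.2) {p : ℝ × ℝ | 0 ≤ p.1})
    (h3 : ContinuousOn (fun p : ℝ × ℝ => vx p.1 p.2) {p : ℝ × ℝ | 0 ≤ p.1})
    (h4 : ∀ t ξ, 0 ≤ t → HasDerivWithinAt (fun s => v s ξ) (vt t ξ) (Set.Ici 0) t)
    (h5 : ∀ t ξ, 0 ≤ t → HasDerivAt (fun y => v t y) (vx t ξ) ξ)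
    (t y : ℝ) (ht : 0 < t) :
    HasDerivAt (fun s => v s (y - c * s)) (vt t (y - c * t) - c * vx t (y - c * t)) t := by
  have hev : ∀ᶠ p : ℝ × ℝ in 𝓝 (t, y - c * t), 0 < p.1 :=
    continuous_fst.continuousAt.eventually (lt_mem_nhds ht)
  have hnb : {p : ℝ × ℝ | 0 ≤ p.1} ∈ 𝓝 (t, y - c * t) := by
    filter_upwards [hev] with p hp using hp.le
  have key := hasStrictFDerivAt_uncurry_coprod (𝕜 := ℝ) (u := (t, y - c * t)) (f := v)
    (f₁ := fun a b => ContinuousLinearMap.toSpanSingleton ℝ (vt a b))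
    (f₂ := fun a b => ContinuousLinearMap.toSpanSingleton ℝ (vx a b)) ?_ ?_ ?_ ?_
  · have hcurve : HasDerivAt (fun s : ℝ => (s, y - c * s)) ((1 : ℝ), -c) t := by
      refine HasDerivAt.prodMk (hasDerivAt_id t) ?_
      simpa using ((hasDerivAt_id t).const_mul c).const_sub y
    have := HasFDerivAt.comp_hasDerivAt t (f := fun s : ℝ => (s, y - c * s)) key.hasFDerivAt hcurve
    convert! this using 1
    simp [Function.HasUncurry.uncurry]
    ring
  · filter_upwards [hev] with p hp
    exact ((h4 p.1 p.2 hp.le).hasDerivAt (Ici_mem_nhds hp)).hasFDerivAt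
  · filter_upwards [hev] with p hp
    exact (h5 p.1 p.2 hp.le).hasFDerivAt
  · have := h2.continuousAt hnb
    exact ((ContinuousLinearMap.toSpanSingletonCLE (𝕜 := ℝ) (E := ℝ)).continuous.continuousAt).comp this
  · have := h3.continuousAt hnb
    exact ((ContinuousLinearMap.toSpanSingletonCLE (𝕜 := ℝ) (E := ℝ)).continuous.continuousAt).comp this

lemma abstract_aux (k : ℝ → ℝ) (hkc : Continuous k) (hk0 : ∀ z, 0 ≤ k z)
    (hki : (∫ z, k z) = 1) (hkp : 0 < k 0)
    (U b : ℝ → ℝ → ℝ) (B : ℝ)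
    (hU1 : ∀ y, ContinuousOn (fun s => U s y) (Ici 0))
    (hU2 : ∀ t, 0 ≤ t → Continuous (U t))
    (hb : ∀ t y, 0 ≤ t → 0 ≤ b t y ∧ b t y ≤ B)
    (hd : ∀ t y, 0 < t → HasDerivAt (fun s => U s y)
      (b t y * U t y + ∫ η, k (η - y) * U t η) t)
    (hbd : ∀ T, ∃ M, ∀ t y, 0 ≤ t → t ≤ T → |U t y| ≤ M)
    (h0 : ∀ y, 0 ≤ U 0 y) (y0 : ℝ) (hy0 : 0 < U 0 y0) :
    ∀ t y, 0 < t → 0 < U t y := by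
  have hkint : Integrable k := by
    by_contra h
    rw [integral_undef h] at hki
    norm_num at hki
  have hkint' : ∀ y, Integrable (fun η => k (η - y)) := fun y => hkint.comp_sub_right y
  have hk1 : ∀ y, (∫ η, k (η - y)) = 1 := fun y => by
    rw [integral_sub_right_eq_self (fun z => k z) y, hki]
  have hint : ∀ t y, 0 ≤ t → Integrable (fun η => k (η - y) * U t η) := by
    intro t y ht
    obtain ⟨M, hM⟩ := hbd t
    exact (hkint' y).mul_bdd (c := M) (hU2 t ht).aestronglyMeasurable
      (Eventually.of_forall fun η => by simpa using hM t η ht le_rfl)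
  have hB : 0 ≤ B := (hb 0 0 le_rfl).1.trans (hb 0 0 le_rfl).2
  -- weak comparison
  have weak : ∀ t y, 0 ≤ t → 0 ≤ U t y := by
    intro T y hT
    obtain ⟨M, hM⟩ := hbd T
    have hM0 : 0 ≤ M := (abs_nonneg _).trans (hM 0 0 le_rfl hT)
    have claim : ∀ n : ℕ, ∀ t y, 0 ≤ t → t ≤ T →
        -(M * (((B + 1) * t) ^ n / (n.factorial : ℝ))) ≤ U t y := by
      intro n
      induction n with
      | zero =>
        intro t y ht htT
        simpa using (abs_le.1 (hM t y ht htT)).1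
      | succ n ih =>
        intro t y ht htT
        have hder : ∀ s, HasDerivAt
            (fun s : ℝ => M * (((B + 1) * s) ^ (n + 1) / ((n + 1).factorial : ℝ)))
            ((B + 1) * (M * (((B + 1) * s) ^ n / (n.factorial : ℝ)))) s := by
          intro s
          have h := ((((hasDerivAt_id s).const_mul (B + 1)).pow (n + 1)).div_const
            ((n + 1).factorial : ℝ)).const_mul M
          convert! h using 1
          have : (n.factorial : ℝ) ≠ 0 := by positivity
          have : (n : ℝ) + 1 ≠ 0 := by positivity
          rw [Nat.factorial_succ]
          push_cast
          simp
          field_simp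
        have mono : MonotoneOn (fun s => U s y +
            M * (((B + 1) * s) ^ (n + 1) / ((n + 1).factorial : ℝ))) (Icc 0 t) := by
          apply monotoneOn_of_deriv_nonneg (convex_Icc 0 t)
          · exact ((hU1 y).mono Icc_subset_Ici_self).add
              (fun s _ => (hder s).continuousAt.continuousWithinAt)
          · rw [interior_Icc]
            intro s hs
            exact ((hd s y hs.1).add (hder s)).differentiableAt.differentiableWithinAt
          · rw [interior_Icc]
            intro s hs
            have hdd := ((hd s y hs.1).add (hder s)).deriv
            rw [show deriv (fun s => U s y +
              M * (((B + 1) * s) ^ (n + 1) / ((n + 1).factorial : ℝ))) s = _ from hdd]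
            set g := M * (((B + 1) * s) ^ n / (n.factorial : ℝ)) with hg
            have hg0 : 0 ≤ g := by
              have := hs.1.le
              positivity
            have hsT : s ≤ T := hs.2.le.trans htT
            have i1 : -g ≤ ∫ η, k (η - y) * U s η := by
              have : (∫ η, k (η - y) * (-g)) = -g := by
                rw [integral_mul_const, hk1, one_mul]
              rw [← this]
              apply integral_mono ((hkint' y).mul_const _) (hint s y hs.1.le)
              intro η
              exact mul_le_mul_of_nonneg_left (ih s η hs.1.le hsT) (hk0 _)
            have i2 : -(B * g) ≤ b s y * U s y := by
              have h1 := mul_le_mul_of_nonneg_left (ih s y hs.1.le hsT) (hb s y hs.1.le).1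
              have h2 := mul_le_mul_of_nonneg_right (hb s y hs.1.le).2 hg0
              rw [← hg] at h1
              linarith
            linarith
        have := mono (left_mem_Icc.2 ht) (right_mem_Icc.2 ht) ht
        simp at this
        have := h0 y
        linarith
    have lim : Tendsto (fun n : ℕ => -(M * (((B + 1) * T) ^ n / (n.factorial : ℝ)))) atTop (𝓝 0) := by
      simpa using ((FloorSemiring.tendsto_pow_div_factorial_atTop ((B + 1) * T)).const_mul M).neg
    exact le_of_tendsto' lim (fun n => claim n T y hT le_rfl)
  have hI0 : ∀ t y, 0 ≤ t → 0 ≤ ∫ η, k (η - y) * U t η := fun t y ht =>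
    integral_nonneg fun η => mul_nonneg (hk0 _) (weak t η ht)
  have mono : ∀ y, MonotoneOn (fun s => U s y) (Ici 0) := by
    intro y
    apply monotoneOn_of_deriv_nonneg (convex_Ici 0) (hU1 y)
    · rw [interior_Ici]
      exact fun s hs => (hd s y hs).differentiableAt.differentiableWithinAt
    · rw [interior_Ici]
      intro s hs
      rw [(hd s y hs).deriv]
      exact add_nonneg (mul_nonneg (hb s y (le_of_lt hs)).1 (weak s y (le_of_lt hs)))
        (hI0 s y (le_of_lt hs))
  obtain ⟨δ, hδ, hkδ⟩ : ∃ δ > 0, ∀ z, |z| ≤ δ → 0 < k z := by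
    have : ∀ᶠ z in 𝓝 (0 : ℝ), 0 < k z := hkc.continuousAt.eventually (lt_mem_nhds hkp)
    obtain ⟨ε, hε, h⟩ := Metric.eventually_nhds_iff.1 this
    refine ⟨ε / 2, by positivity, fun z hz => h ?_⟩
    rw [Real.dist_eq, sub_zero]
    linarith
  have step : ∀ s t y y', 0 ≤ s → s < t → 0 < U s y' → |y' - y| ≤ δ → 0 < U t y := by
    intro s t y y' hs hst hU hyy
    have sm : StrictMonoOn (fun τ => U τ y) (Icc s t) := by
      apply strictMonoOn_of_deriv_pos (convex_Icc s t)
        ((hU1 y).mono (fun τ hτ => hs.trans hτ.1))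
      rw [interior_Icc]
      intro τ hτ
      have hτ0 : 0 < τ := hs.trans_lt hτ.1
      rw [(hd τ y hτ0).deriv]
      refine add_pos_of_nonneg_of_pos
        (mul_nonneg (hb τ y hτ0.le).1 (weak τ y hτ0.le)) ?_
      refine integral_pos_of_integrable_nonneg_nonzero (x := y') ?_ (hint τ y hτ0.le)
        (fun η => mul_nonneg (hk0 _) (weak τ η hτ0.le)) ?_
      · exact (hkc.comp (continuous_id.sub continuous_const)).mul (hU2 τ hτ0.le)
      · exact (mul_pos (hkδ _ hyy)
          (hU.trans_le (mono y' hs hτ0.le hτ.1.le))).ne'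
    exact (weak s y hs).trans_lt (sm (left_mem_Icc.2 hst.le) (right_mem_Icc.2 hst.le) hst)
  have spread : ∀ n : ℕ, ∀ t y, 0 < t → |y - y0| ≤ n * δ → 0 < U t y := by
    intro n
    induction n with
    | zero =>
      intro t y ht hy
      simp at hy
      have : y = y0 := by linarith
      subst this
      exact hy0.trans_le (mono y (le_refl (0:ℝ)) ht.le ht.le)
    | succ n ih =>
      intro t y ht hy
      push_cast at hy
      have hn : (0 : ℝ) < n + 1 := by positivity
      -- intermediate point
      refine step (t / 2) t y (y0 + (y - y0) * (n / (n + 1))) (by positivity) (by linarith)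
        (ih _ _ (by positivity) ?_) ?_
      · rw [add_sub_cancel_left, abs_mul, abs_of_nonneg (by positivity : (0 : ℝ) ≤ n / (n + 1))]
        calc |y - y0| * (n / (n + 1)) ≤ ((n + 1) * δ) * (n / (n + 1)) := by gcongr
          _ = n * δ := by field_simp
      · have : y0 + (y - y0) * (n / (n + 1)) - y = -((y - y0) / (n + 1)) := by
          field_simp
          ring
        rw [this, abs_neg, abs_div, abs_of_pos hn, div_le_iff₀ hn]
        linarith
  intro t y ht
  obtain ⟨n, hn⟩ := exists_nat_ge (|y - y0| / δ)
  exact spread n t y ht ((div_le_iff₀ hδ).1 hn)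

/-- Strong comparison principle for the nonlinear nonlocal equation (E). -/
theorem strong_comparison_nonlinear
    (k : ℝ → ℝ) (hk : H1 k)
    (r q L L0 : ℝ) (χ : ℝ → ℝ) (hχ : IsH2chi r q L L0 χ)
    (c : ℝ) (hc : 0 ≤ c)
    (v₁ v₁t v₁x v₂ v₂t v₂x : ℝ → ℝ → ℝ)
    (hv₁ : IsClassicalSol c k (fH2 r q χ) v₁ v₁t v₁x)
    (hv₂ : IsClassicalSol c k (fH2 r q χ) v₂ v₂t v₂x)
    (hinit : ∀ ξ, v₁ 0 ξ ≤ v₂ 0 ξ)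
    (hne : ∃ ξ, v₁ 0 ξ ≠ v₂ 0 ξ) :
    ∀ t ξ, 0 < t → v₁ t ξ < v₂ t ξ := by
  obtain ⟨hkC, hk0, -, hki, hkp, -⟩ := hk
  obtain ⟨hr, hq, -, -, hχC, hχ01, -⟩ := hχ
  obtain ⟨⟨C₁, hC₁⟩, a1, a2, a3, a4, a5, a6⟩ := hv₁
  obtain ⟨⟨C₂, hC₂⟩, b1, b2, b3, b4, b5, b6⟩ := hv₂
  have hkint : Integrable k := by
    by_contra h
    rw [integral_undef h] at hki
    norm_num at hki
  have cont : ∀ v : ℝ → ℝ → ℝ,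
      ContinuousOn (fun p : ℝ × ℝ => v p.1 p.2) {p : ℝ × ℝ | 0 ≤ p.1} →
      ∀ t, 0 ≤ t → Continuous (v t) := by
    intro v hv t ht
    exact hv.comp_continuous (f := fun y : ℝ => (t, y)) (by fun_prop) (fun _ => ht)
  have contc : ∀ v : ℝ → ℝ → ℝ,
      ContinuousOn (fun p : ℝ × ℝ => v p.1 p.2) {p : ℝ × ℝ | 0 ≤ p.1} →
      ∀ y, ContinuousOn (fun s => v s (y - c * s)) (Ici 0) := by
    intro v hv y
    exact hv.comp (f := fun s : ℝ => (s, y - c * s)) (by fun_prop) (fun _ h => h)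
  have hint : ∀ (v : ℝ → ℝ → ℝ) (C : ℝ), (∀ t ξ, 0 ≤ t → |v t ξ| ≤ C) →
      ContinuousOn (fun p : ℝ × ℝ => v p.1 p.2) {p : ℝ × ℝ | 0 ≤ p.1} →
      ∀ t ξ, 0 ≤ t → Integrable (fun η => k (η - ξ) * v t η) := by
    intro v C hC hv t ξ ht
    exact (hkint.comp_sub_right ξ).mul_bdd (c := C) (cont v hv t ht).aestronglyMeasurable
      (Eventually.of_forall fun η => by simpa using hC t η ht)
  set A : ℝ := q + (r + q) + r * (C₁ + C₂) with hA
  let a : ℝ → ℝ → ℝ := fun t ξ => -q + (r + q) * χ ξ - r * χ ξ * (v₁ t ξ + v₂ t ξ)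
  have ha : ∀ t ξ, 0 ≤ t → |a t ξ| ≤ A := by
    intro t ξ ht
    have h1 := hC₁ t ξ ht
    have h2 := hC₂ t ξ ht
    obtain ⟨x0, x1⟩ := hχ01 ξ
    have hs : |v₁ t ξ + v₂ t ξ| ≤ C₁ + C₂ := (abs_add_le _ _).trans (add_le_add h1 h2)
    have e1 : |r * χ ξ * (v₁ t ξ + v₂ t ξ)| ≤ r * (C₁ + C₂) := by
      rw [abs_mul, abs_of_nonneg (by positivity : 0 ≤ r * χ ξ)]
      have : r * χ ξ ≤ r := by nlinarith
      exact mul_le_mul this hs (abs_nonneg _) hr.le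
    have e2 : (r + q) * χ ξ ≤ r + q := by nlinarith
    have e3 : 0 ≤ (r + q) * χ ξ := by positivity
    obtain ⟨e4, e5⟩ := abs_le.1 e1
    rw [abs_le]
    constructor <;> simp only [a, hA] <;> linarith
  have hpos := abstract_aux k hkC.continuous hk0 hki hkp
    (fun t y => Real.exp ((1 + A) * t) * (v₂ t (y - c * t) - v₁ t (y - c * t)))
    (fun t y => A + a t (y - c * t)) (2 * A) ?_ ?_ ?_ ?_ ?_ ?_
  · obtain ⟨y0, hy0⟩ := hne
    have hlt : v₁ 0 y0 < v₂ 0 y0 := lt_of_le_of_ne (hinit y0) hy0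
    intro t ξ ht
    have := hpos y0 (by simpa using hlt) t (ξ + c * t) ht
    simp only [add_sub_cancel_right] at this
    exact sub_pos.1 (pos_of_mul_pos_right this (Real.exp_pos _).le)
  · intro y
    exact ContinuousOn.mul (by fun_prop) ((contc _ b1 y).sub (contc _ a1 y))
  · intro t ht
    have h1 := cont _ a1 t ht
    have h2 := cont _ b1 t ht
    fun_prop
  · intro t y ht
    obtain ⟨h1, h2⟩ := abs_le.1 (ha t (y - c * t) ht)
    constructor <;> linarith
  · intro t y ht
    have d1 := chain_aux c v₁ v₁t v₁x a2 a3 a4 a5 t y ht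
    have d2 := chain_aux c v₂ v₂t v₂x b2 b3 b4 b5 t y ht
    have de : HasDerivAt (fun s : ℝ => Real.exp ((1 + A) * s))
        (Real.exp ((1 + A) * t) * (1 + A)) t := by
      simpa using ((hasDerivAt_id t).const_mul (1 + A)).exp
    have hI : (∫ η, k (η - y) * (Real.exp ((1 + A) * t) *
        (v₂ t (η - c * t) - v₁ t (η - c * t)))) =
        Real.exp ((1 + A) * t) * ((∫ η, k (η - (y - c * t)) * v₂ t η) -
          ∫ η, k (η - (y - c * t)) * v₁ t η) := by
      rw [← integral_sub (hint _ _ hC₂ b1 t _ ht.le) (hint _ _ hC₁ a1 t _ ht.le),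
        ← integral_const_mul,
        ← integral_sub_right_eq_self (fun η => Real.exp ((1 + A) * t) *
          (k (η - (y - c * t)) * v₂ t η - k (η - (y - c * t)) * v₁ t η)) (c * t)]
      congr 1
      ext η
      rw [show η - c * t - (y - c * t) = η - y by ring]
      ring
    convert! de.mul (d2.sub d1) using 1
    rw [hI, a6 t _ ht.le, b6 t _ ht.le]
    simp only [fH2, a, Pi.sub_apply]
    ring
  · intro T
    refine ⟨Real.exp ((1 + A) * T) * (C₂ + C₁), ?_⟩
    intro t y ht htT
    have hA0 : 0 ≤ A := (abs_nonneg _).trans (ha t y ht)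
    rw [abs_mul, abs_of_pos (Real.exp_pos _)]
    refine mul_le_mul (Real.exp_le_exp.2 (by nlinarith)) ?_ (abs_nonneg _) (Real.exp_pos _).le
    exact (abs_sub _ _).trans (add_le_add (hC₂ _ _ ht) (hC₁ _ _ ht))
  · intro y
    simpa using hinit y
end
end

section
/- (Comparison principle for the nonlocal Dirichlet boundary problem.) Assume (H1). Let c≥0, let a<b be real numbers, let t₀∈ℝ and T>0, let m:ℝ→ℝ be continuous with m(ξ)<0 for all ξ∈(a,b), and let ḡ,g̲:ℝ→ℝ satisfy ḡ(ξ) ≥ g̲(ξ) for all ξ∉(a,b). Suppose ū,v̲:[t₀,t₀+T]×ℝ→ℝ are continuous and bounded, have continuous partial derivatives ∂_t and ∂_ξ, and satisfy, for every t∈[t₀,t₀+T]: ∂_t ū(t,ξ) ≥ c ∂_ξ ū(t,ξ)+∫_ℝ k(η−ξ) ū(t,η) dη − ū(t,ξ) + m(ξ) ū(t,ξ) for all ξ∈(a,b), and ū(t,ξ) ≥ ḡ(ξ) for all ξ∉(a,b); while ∂_t v̲(t,ξ) ≤ c ∂_ξ v̲(t,ξ)+∫_ℝ k(η−ξ) v̲(t,η)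 dη − v̲(t,ξ) + m(ξ) v̲(t,ξ) for all ξ∈(a,b), and v̲(t,ξ) ≤ g̲(ξ) for all ξ∉(a,b). If ū(t₀,ξ) ≥ v̲(t₀,ξ) for all ξ∈[a,b], then ū(t,ξ) ≥ v̲(t,ξ) for all t∈[t₀,t₀+T] and all ξ∈[a,b]. -/
open MeasureTheory Real Set Filter Topology

noncomputable section

/-- Comparison principle for the nonlocal Dirichlet boundary problem. -/
theorem comparison_principle_dirichlet
    (k : ℝ → ℝ) (hk : H1 k) (c : ℝ) (hc : 0 ≤ c)
    (a b : ℝ) (hab : a < b) (t₀ T : ℝ) (hT : 0 < T)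
    (m : ℝ → ℝ) (hmC : Continuous m) (hm : ∀ ξ ∈ Set.Ioo a b, m ξ < 0)
    (gbar glow : ℝ → ℝ) (hg : ∀ ξ, ξ ∉ Set.Ioo a b → glow ξ ≤ gbar ξ)
    (u ut ux vl vlt vlx : ℝ → ℝ → ℝ)
    (huC : ContinuousOn (fun p : ℝ × ℝ => u p.1 p.2) (Set.Icc t₀ (t₀ + T) ×ˢ Set.univ))
    (hutC : ContinuousOn (fun p : ℝ × ℝ => ut p.1 p.2) (Set.Icc t₀ (t₀ + T) ×ˢ Set.univ))
    (huxC : ContinuousOn (fun p : ℝ × ℝ => ux p.1 p.2) (Set.Icc t₀ (t₀ + T) ×ˢ Set.univ))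
    (hvlC : ContinuousOn (fun p : ℝ × ℝ => vl p.1 p.2) (Set.Icc t₀ (t₀ + T) ×ˢ Set.univ))
    (hvltC : ContinuousOn (fun p : ℝ × ℝ => vlt p.1 p.2) (Set.Icc t₀ (t₀ + T) ×ˢ Set.univ))
    (hvlxC : ContinuousOn (fun p : ℝ × ℝ => vlx p.1 p.2) (Set.Icc t₀ (t₀ + T) ×ˢ Set.univ))
    (huB : ∃ C, ∀ t ∈ Set.Icc t₀ (t₀ + T), ∀ ξ, |u t ξ| ≤ C)
    (hvlB : ∃ C, ∀ t ∈ Set.Icc t₀ (t₀ + T), ∀ ξ, |vl t ξ| ≤ C)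
    (huder_t : ∀ t ∈ Set.Icc t₀ (t₀ + T), ∀ ξ,
      HasDerivWithinAt (fun s => u s ξ) (ut t ξ) (Set.Icc t₀ (t₀ + T)) t)
    (huder_x : ∀ t ∈ Set.Icc t₀ (t₀ + T), ∀ ξ, HasDerivAt (fun y => u t y) (ux t ξ) ξ)
    (hvlder_t : ∀ t ∈ Set.Icc t₀ (t₀ + T), ∀ ξ,
      HasDerivWithinAt (fun s => vl s ξ) (vlt t ξ) (Set.Icc t₀ (t₀ + T)) t)
    (hvlder_x : ∀ t ∈ Set.Icc t₀ (t₀ + T), ∀ ξ, HasDerivAt (fun y => vl t y) (vlx t ξ) ξ)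
    (hsuper : ∀ t ∈ Set.Icc t₀ (t₀ + T), ∀ ξ ∈ Set.Ioo a b,
      c * ux t ξ + ((∫ η, k (η - ξ) * u t η) - u t ξ) + m ξ * u t ξ ≤ ut t ξ)
    (hsuperbc : ∀ t ∈ Set.Icc t₀ (t₀ + T), ∀ ξ, ξ ∉ Set.Ioo a b → gbar ξ ≤ u t ξ)
    (hsub : ∀ t ∈ Set.Icc t₀ (t₀ + T), ∀ ξ ∈ Set.Ioo a b,
      vlt t ξ ≤ c * vlx t ξ + ((∫ η, k (η - ξ) * vl t η) - vl t ξ) + m ξ * vl t ξ)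
    (hsubbc : ∀ t ∈ Set.Icc t₀ (t₀ + T), ∀ ξ, ξ ∉ Set.Ioo a b → vl t ξ ≤ glow ξ)
    (hinit : ∀ ξ ∈ Set.Icc a b, vl t₀ ξ ≤ u t₀ ξ) :
    ∀ t ∈ Set.Icc t₀ (t₀ + T), ∀ ξ ∈ Set.Icc a b, vl t ξ ≤ u t ξ := by
  by_contra hcon
  push Not at hcon
  obtain ⟨t₁, ht₁, ξ₁, hξ₁, hlt⟩ := hcon
  obtain ⟨-, hk0, -, hkint, -, -⟩ := hk
  obtain ⟨Cu, hCu⟩ := huB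
  obtain ⟨Cv, hCv⟩ := hvlB
  have hki : Integrable k := by
    by_contra h
    rw [integral_undef h] at hkint
    exact zero_ne_one hkint
  have hcomp : IsCompact (Set.Icc t₀ (t₀ + T) ×ˢ Set.Icc a b) := isCompact_Icc.prod isCompact_Icc
  have hwC : ContinuousOn (fun p : ℝ × ℝ => u p.1 p.2 - vl p.1 p.2)
      (Set.Icc t₀ (t₀ + T) ×ˢ Set.Icc a b) :=
    (huC.sub hvlC).mono (Set.prod_mono le_rfl (Set.subset_univ _))
  obtain ⟨⟨t, x⟩, ⟨ht, hx⟩, hmin⟩ := hcomp.exists_isMinOn ⟨(t₁, ξ₁), ht₁, hξ₁⟩ hwC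
  simp only at ht hx
  have hmin' : ∀ s ∈ Set.Icc t₀ (t₀ + T), ∀ y ∈ Set.Icc a b,
      u t x - vl t x ≤ u s y - vl s y := fun s hs y hy => hmin (a := (s, y)) ⟨hs, hy⟩
  have hneg : u t x - vl t x < 0 := by linarith [hmin' t₁ ht₁ ξ₁ hξ₁]
  have hout : ∀ y, y ∉ Set.Ioo a b → 0 ≤ u t y - vl t y := fun y hy => by
    linarith [hg y hy, hsuperbc t ht y hy, hsubbc t ht y hy]
  have hxI : x ∈ Set.Ioo a b := by
    by_contra h
    linarith [hout x h]
  have hall : ∀ y, u t x - vl t x ≤ u t y - vl t y := fun y => by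
    by_cases hy : y ∈ Set.Ioo a b
    · exact hmin' t ht y (Set.Ioo_subset_Icc_self hy)
    · linarith [hout y hy]
  have htt : t₀ < t := by
    rcases ht.1.eq_or_lt with h | h
    · subst h
      linarith [hinit x hx]
    · exact h
  have hx0 : ux t x - vlx t x = 0 := by
    have hd : HasDerivAt (fun y => u t y - vl t y) (ux t x - vlx t x) x :=
      (huder_x t ht x).sub (hvlder_x t ht x)
    exact IsLocalMin.hasDerivAt_eq_zero (Filter.Eventually.of_forall hall) hd
  have ht0 : ut t x - vlt t x ≤ 0 := by
    have hd : HasDerivWithinAt (fun s => u s x - vl s x) (ut t x - vlt t x)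
        (Set.Icc t₀ (t₀ + T)) t := (huder_t t ht x).sub (hvlder_t t ht x)
    have hm' : IsLocalMinOn (fun s => u s x - vl s x) (Set.Icc t₀ (t₀ + T)) t := by
      refine IsMinOn.localize ?_
      intro s hs
      exact hmin' s hs x hx
    have hseg : t₀ - t ∈ posTangentConeAt (Set.Icc t₀ (t₀ + T)) t :=
      sub_mem_posTangentConeAt_of_segment_subset
        ((convex_Icc _ _).segment_subset ht ⟨le_rfl, by linarith⟩)
    have := hm'.hasFDerivWithinAt_nonneg hd.hasFDerivWithinAt hseg
    simp at this
    nlinarith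
  have hcont : ∀ f : ℝ → ℝ → ℝ,
      ContinuousOn (fun p : ℝ × ℝ => f p.1 p.2) (Set.Icc t₀ (t₀ + T) ×ˢ Set.univ) →
      Continuous (f t) := fun f hf =>
    hf.comp_continuous (f := fun y => (t, y)) (by fun_prop) (fun y => ⟨ht, trivial⟩)
  have hks : Integrable (fun η => k (η - x)) := hki.comp_sub_right x
  have hiu : Integrable (fun η => k (η - x) * u t η) :=
    hks.mul_bdd (c := Cu) (hcont u huC).aestronglyMeasurable
      (Filter.Eventually.of_forall fun y => hCu t ht y)
  have hiv : Integrable (fun η => k (η - x) * vl t η) :=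
    hks.mul_bdd (c := Cv) (hcont vl hvlC).aestronglyMeasurable
      (Filter.Eventually.of_forall fun y => hCv t ht y)
  have hI : u t x - vl t x ≤ (∫ η, k (η - x) * u t η) - ∫ η, k (η - x) * vl t η := by
    rw [← integral_sub hiu hiv]
    have h1 : ∫ η, k (η - x) * (u t x - vl t x) = u t x - vl t x := by
      rw [integral_mul_const, integral_sub_right_eq_self k x, hkint, one_mul]
    rw [← h1]
    refine integral_mono (hks.mul_const _) (hiu.sub hiv) fun y => ?_
    have := mul_le_mul_of_nonneg_left (hall y) (hk0 (y - x))
    simp only [Pi.sub_apply]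
    linarith
  have e1 := hsuper t ht x hxI
  have e2 := hsub t ht x hxI
  have e3 := mul_pos_of_neg_of_neg (hm x hxI) hneg
  have e4 : c * ux t x - c * vlx t x = 0 := by rw [← mul_sub, hx0, mul_zero]
  linarith
end
end

section
/- (Existence and uniqueness of the characteristic roots μ₋(λ) and μ₊(λ).) Assume (H1) and (EXP). Let c≥0, q>0 and λ>−q, and define g:ℝ→ℝ by g(μ)=cμ+∫_ℝ e^{μη} k(η) dη − 1 − q − λ. Then g has exactly two real zeros μ₋(λ) and μ₊(λ), which satisfy μ₋(λ)<0<μ₊(λ); moreover g(μ)<0 for μ∈(μ₋(λ),μ₊(λ)) and g(μ)>0 for μ<μ₋(λ) and for μ>μ₊(λ). -/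
open MeasureTheory Real Set Filter Topology

noncomputable section

theorem half_root (G : ℝ → ℝ) (hG : ConvexOn ℝ univ G) (h0 : G 0 < 0)
    (b : ℝ) (hb : 0 < b) (hGb : 0 < G b) :
    ∃ p, 0 < p ∧ G p = 0 ∧ (∀ x, 0 ≤ x → x < p → G x < 0) ∧ (∀ x, p < x → 0 < G x) := by
  have hcont : Continuous G := by
    have := hG.continuousOn isOpen_univ
    exact continuousOn_univ.mp this
  obtain ⟨p, hp, hp0⟩ := intermediate_value_Icc hb.le hcont.continuousOn
    (show (0:ℝ) ∈ Icc (G 0) (G b) from ⟨h0.le, hGb.le⟩)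
  have hpp : 0 < p := by
    rcases hp.1.eq_or_lt with h | h
    · rw [← h] at hp0; linarith
    · exact h
  have key : ∀ x y, 0 ≤ x → x < y → y * G x ≤ (y - x) * G 0 + x * G y := by
    intro x y hx hxy
    have hy : 0 < y := by linarith
    have := hG.2 (mem_univ 0) (mem_univ y) (show 0 ≤ (y - x) / y from div_nonneg (by linarith) hy.le)
      (show 0 ≤ x / y from div_nonneg hx hy.le) (by field_simp; ring)
    simp only [smul_eq_mul, mul_zero, zero_add] at this
    rw [div_mul_cancel₀ _ hy.ne'] at this
    calc y * G x ≤ y * ((y - x) / y * G 0 + x / y * G y) := by gcongr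
      _ = _ := by field_simp
  refine ⟨p, hpp, hp0, ?_, ?_⟩
  · intro x hx hxp
    have := key x p hx hxp
    rw [hp0] at this
    by_contra! h
    nlinarith [mul_pos (sub_pos.2 hxp) (neg_pos.2 h0), mul_nonneg hpp.le h]
  · intro x hx
    have := key p x hpp.le hx
    rw [hp0] at this
    by_contra! h
    nlinarith [mul_pos (sub_pos.2 hx) (neg_pos.2 h0), mul_nonneg hpp.le (neg_nonneg.2 h)]

theorem sq_le_exp_add (x : ℝ) : x ^ 2 ≤ Real.exp x + Real.exp (-x) := by
  have h := Real.quadratic_le_exp_of_nonneg (abs_nonneg x)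
  have h2 := Real.add_one_le_exp (-|x|)
  have h3 := Real.exp_pos (-|x|)
  have e : Real.exp x + Real.exp (-x) = Real.exp |x| + Real.exp (-|x|) := by
    rcases abs_cases x with ⟨h, _⟩ | ⟨h, _⟩ <;> rw [h]
    rw [neg_neg, add_comm]
  have := Real.one_sub_sq_div_two_le_cos (x := x)
  have hc := Real.cosh_sq |x|
  have h5 : Real.sinh (|x|/2) ≥ |x|/2 := Real.self_le_sinh_iff.2 (by positivity)
  have h6 := Real.cosh_two_mul (|x|/2)
  have h7 := Real.cosh_sq (|x|/2)
  rw [mul_div_cancel₀ _ (by norm_num : (2:ℝ) ≠ 0), Real.cosh_eq] at h6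
  rw [e, ← sq_abs]
  nlinarith [abs_nonneg x]

/-- Existence and uniqueness of the characteristic roots `μ₋(λ) < 0 < μ₊(λ)`. -/
theorem characteristic_roots
    (k : ℝ → ℝ) (hk : H1 k) (hexp : EXPk k)
    (c q lam : ℝ) (hc : 0 ≤ c) (hq : 0 < q) (hlam : -q < lam)
    (g : ℝ → ℝ)
    (hg : ∀ μ, g μ = c * μ + (∫ η, Real.exp (μ * η) * k η) - 1 - q - lam) :
    ∃ μm μp : ℝ, μm < 0 ∧ 0 < μp ∧ g μm = 0 ∧ g μp = 0 ∧
      (∀ μ, g μ = 0 → μ = μm ∨ μ = μp) ∧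
      (∀ μ, μm < μ → μ < μp → g μ < 0) ∧
      (∀ μ, μ < μm → 0 < g μ) ∧
      (∀ μ, μp < μ → 0 < g μ) := by
  obtain ⟨hC, hnn, hev, hint, hk0, -⟩ := hk
  have hkc : Continuous k := hC.continuous
  set I : ℝ → ℝ := fun μ => ∫ η, Real.exp (μ * η) * k η with hI
  have hIeven : ∀ μ, I (-μ) = I μ := by
    intro μ
    simp only [hI]
    rw [← integral_neg_eq_self (fun η => Real.exp (μ * η) * k η)]
    congr 1; ext η
    rw [hev]; ring_nf
  have hI0 : I 0 = 1 := by simp [hI, hint]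
  have hconvI : ConvexOn ℝ univ I := by
    refine ⟨convex_univ, ?_⟩
    intro x _ y _ a b ha hb hab
    simp only [hI, smul_eq_mul]
    rw [← integral_const_mul, ← integral_const_mul, ← integral_add ((hexp x).const_mul a) ((hexp y).const_mul b)]
    refine integral_mono (hexp _) (((hexp x).const_mul a).add ((hexp y).const_mul b)) ?_
    intro η
    have := convexOn_exp.2 (mem_univ (x * η)) (mem_univ (y * η)) ha hb hab
    simp only [smul_eq_mul] at this
    have h2 := mul_le_mul_of_nonneg_right this (hnn η)
    calc Real.exp ((a * x + b * y) * η) * k η = Real.exp (a * (x * η) + b * (y * η)) * k η := by ring_nf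
      _ ≤ _ := h2
      _ = _ := by simp only [Pi.add_apply]; ring
  have hAi : Integrable (fun η => η ^ 2 * k η) := by
    refine Integrable.mono' ((hexp 1).add (hexp (-1))) (by fun_prop) (ae_of_all _ fun η => ?_)
    rw [Real.norm_of_nonneg (mul_nonneg (sq_nonneg _) (hnn η))]
    have := mul_le_mul_of_nonneg_right (sq_le_exp_add η) (hnn η)
    simp only [Pi.add_apply, one_mul, neg_mul]
    linarith
  set A := ∫ η, η ^ 2 * k η with hA
  have hApos : 0 < A := by
    obtain ⟨ε, hε, hball⟩ := Metric.eventually_nhds_iff.1 (hkc.continuousAt.eventually (lt_mem_nhds hk0))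
    have hx : 0 < k (ε / 2) := hball (by rw [Real.dist_eq, sub_zero, abs_of_pos (by positivity)]; linarith)
    have hne : (ε / 2) ^ 2 * k (ε / 2) ≠ 0 := by positivity
    exact integral_pos_of_integrable_nonneg_nonzero (f := fun η => η ^ 2 * k η) (x := ε / 2) (by fun_prop) hAi
      (fun η => mul_nonneg (sq_nonneg _) (hnn η)) hne
  have hlow : ∀ μ, μ ^ 2 * A ≤ 2 * I μ := by
    intro μ
    have e : 2 * I μ = ∫ η, (Real.exp (μ * η) * k η + Real.exp (-μ * η) * k η) := by
      rw [integral_add (hexp μ) (hexp (-μ))]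
      have := hIeven μ
      simp only [hI] at this ⊢
      rw [this]; ring
    rw [e, hA, ← integral_const_mul]
    refine integral_mono (hAi.const_mul _) ((hexp μ).add (hexp (-μ))) fun η => ?_
    have := mul_le_mul_of_nonneg_right (sq_le_exp_add (μ * η)) (hnn η)
    simp only [neg_mul]
    nlinarith
  have hg' : ∀ μ, g μ = c * μ + I μ - 1 - q - lam := hg
  have hgc : ConvexOn ℝ univ g := by
    refine ⟨convex_univ, ?_⟩
    intro x _ y _ a b ha hb hab
    have := hconvI.2 (mem_univ x) (mem_univ y) ha hb hab
    simp only [smul_eq_mul, hg'] at this ⊢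
    have hb' : b = 1 - a := by linarith
    subst hb'
    linarith
  have hgc' : ConvexOn ℝ univ (fun x => g (-x)) := by
    refine ⟨convex_univ, ?_⟩
    intro x _ y _ a b ha hb hab
    have := hgc.2 (mem_univ (-x)) (mem_univ (-y)) ha hb hab
    simp only [smul_eq_mul] at this ⊢
    rw [show -(a * x + b * y) = a * -x + b * -y by ring]
    exact this
  have hg0 : g 0 < 0 := by rw [hg', hI0]; linarith
  obtain ⟨b, hb, hb1⟩ : ∃ b : ℝ, 0 < b ∧ 0 < -c * b + I b - 1 - q - lam := by
    refine ⟨2 * (c + 1 + q + lam) / A + 1, by have : 0 < 2 * (c + 1 + q + lam) / A := div_pos (by linarith) hApos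
                                              linarith, ?_⟩
    set b := 2 * (c + 1 + q + lam) / A + 1 with hbd
    have h1 : b * A = 2 * (c + 1 + q + lam) + A := by rw [hbd]; field_simp
    have hb1 : 1 ≤ b := by
      have : 0 < 2 * (c + 1 + q + lam) / A := div_pos (by linarith) hApos
      linarith
    have h2 := hlow b
    have h3 : b ^ 2 * A = b * (2 * (c + 1 + q + lam) + A) := by rw [← h1]; ring
    nlinarith [mul_nonneg (sub_nonneg.2 hb1) (show 0 ≤ 1 + q + lam by linarith), mul_pos (show 0 < b by linarith) hApos]
  have hgb : 0 < g b := by rw [hg']; nlinarith [mul_nonneg hc hb.le]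
  have hgb' : 0 < g (-b) := by rw [hg', hIeven]; linarith
  obtain ⟨p, hp, hp0, hp1, hp2⟩ := half_root g hgc hg0 b hb hgb
  obtain ⟨m, hm, hm0, hm1, hm2⟩ := half_root (fun x => g (-x)) hgc' (by simpa using hg0) b hb hgb'
  have hneg : ∀ μ, -m < μ → μ < p → g μ < 0 := by
    intro μ h1 h2
    rcases le_total 0 μ with h | h
    · exact hp1 μ h h2
    · simpa using hm1 (-μ) (by linarith) (by linarith)
  have hleft : ∀ μ, μ < -m → 0 < g μ := by
    intro μ h
    simpa using hm2 (-μ) (by linarith)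
  refine ⟨-m, p, by linarith, hp, hm0, hp0, ?_, hneg, hleft, hp2⟩
  intro μ hμ
  by_contra! h
  rcases lt_or_gt_of_ne h.1 with h1 | h1
  · linarith [hleft μ h1]
  · rcases lt_or_gt_of_ne h.2 with h2 | h2
    · linarith [hneg μ h1 h2]
    · linarith [hp2 μ h2]
end
end

section
/- (Explicit exponential super-solutions of the linear nonlocal Dirichlet problem.) Assume (H1) and (EXP). Let c≥0, q>0, M>0, R∈ℝ and τ>0, and let μ₋<0<μ₊ be the two roots of cμ+∫_ℝ e^{μη} k(η) dη − 1 − q = 0. Define k₁ = M(e^{μ₊τ}−1)/(e^{μ₊τ}−e^{μ₋τ}), k₂ = M(1−e^{μ₋τ})/(e^{μ₊τ}−e^{μ₋τ}), and ψ(ξ) = k₁ e^{μ₋(ξ−R)} + k₂ e^{μ₊(ξ−R)}. Then c ψ'(ξ)+∫_ℝ k(η−ξ) ψ(η) dη − ψ(ξ) − q ψ(ξ) = 0 for every ξ∈ℝ, ψ(R)=ψ(R+τ)=M, and ψ(ξ) ≥ M for every ξ ≤ R and every ξ ≥ R+τ. -/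
open MeasureTheory Real Set Filter Topology

noncomputable section

theorem aux_conv (μ x y z : ℝ) (hxy : x ≤ y) (hyz : y ≤ z) :
    (z - x) * Real.exp (μ * y) ≤ (z - y) * Real.exp (μ * x) + (y - x) * Real.exp (μ * z) := by
  have key : ∀ w, Real.exp (μ * y) * (1 + μ * (w - y)) ≤ Real.exp (μ * w) := by
    intro w
    have h := Real.add_one_le_exp (μ * (w - y))
    have e : Real.exp (μ * w) = Real.exp (μ * y) * Real.exp (μ * (w - y)) := by
      rw [← Real.exp_add]; congr 1; ring
    rw [e]
    exact mul_le_mul_of_nonneg_left (by linarith) (Real.exp_pos _).le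
  have h1 := mul_le_mul_of_nonneg_left (key x) (sub_nonneg.2 hyz)
  have h2 := mul_le_mul_of_nonneg_left (key z) (sub_nonneg.2 hxy)
  nlinarith [h1, h2]

theorem aux_int (k : ℝ → ℝ) (hexp : EXPk k) (μ R ξ : ℝ) :
    Integrable (fun η => k (η - ξ) * Real.exp (μ * (η - R))) ∧
    (∫ η, k (η - ξ) * Real.exp (μ * (η - R)))
      = Real.exp (μ * (ξ - R)) * ∫ η, Real.exp (μ * η) * k η := by
  have e : (fun η => k (η - ξ) * Real.exp (μ * (η - R)))
      = fun η => Real.exp (μ * (ξ - R)) * (Real.exp (μ * (η - ξ)) * k (η - ξ)) := by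
    funext η
    have : Real.exp (μ * (η - R)) = Real.exp (μ * (ξ - R)) * Real.exp (μ * (η - ξ)) := by
      rw [← Real.exp_add]; congr 1; ring
    rw [this]; ring
  rw [e]
  constructor
  · exact ((hexp μ).comp_sub_right ξ).const_mul _
  · rw [integral_const_mul, integral_sub_right_eq_self (fun η => Real.exp (μ * η) * k η) ξ]

/-- Explicit exponential super-solutions of the linear nonlocal
Dirichlet problem. -/
theorem exponential_supersolution
    (k : ℝ → ℝ) (hk : H1 k) (hexp : EXPk k)
    (c q M R τ : ℝ) (hc : 0 ≤ c) (hq : 0 < q) (hM : 0 < M) (hτ : 0 < τ)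
    (μm μp : ℝ) (hμm : μm < 0) (hμp : 0 < μp)
    (hrootm : c * μm + (∫ η, Real.exp (μm * η) * k η) - 1 - q = 0)
    (hrootp : c * μp + (∫ η, Real.exp (μp * η) * k η) - 1 - q = 0)
    (k₁ k₂ : ℝ)
    (hk₁ : k₁ = M * (Real.exp (μp * τ) - 1) / (Real.exp (μp * τ) - Real.exp (μm * τ)))
    (hk₂ : k₂ = M * (1 - Real.exp (μm * τ)) / (Real.exp (μp * τ) - Real.exp (μm * τ)))
    (ψ : ℝ → ℝ)
    (hψ : ∀ ξ, ψ ξ = k₁ * Real.exp (μm * (ξ - R)) + k₂ * Real.exp (μp * (ξ - R))) :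
    (∀ ξ, c * deriv ψ ξ + ((∫ η, k (η - ξ) * ψ η) - ψ ξ) - q * ψ ξ = 0) ∧
    ψ R = M ∧ ψ (R + τ) = M ∧
    (∀ ξ, ξ ≤ R → M ≤ ψ ξ) ∧ (∀ ξ, R + τ ≤ ξ → M ≤ ψ ξ) := by
  have hep : 1 < Real.exp (μp * τ) := Real.one_lt_exp_iff.2 (mul_pos hμp hτ)
  have hem : Real.exp (μm * τ) < 1 := by
    rw [← Real.exp_zero]; exact Real.exp_lt_exp.2 (mul_neg_of_neg_of_pos hμm hτ)
  have hD : 0 < Real.exp (μp * τ) - Real.exp (μm * τ) := by linarith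
  have h1 : 0 ≤ k₁ := by
    rw [hk₁]; exact div_nonneg (mul_nonneg hM.le (by linarith)) hD.le
  have h2 : 0 ≤ k₂ := by
    rw [hk₂]; exact div_nonneg (mul_nonneg hM.le (by linarith)) hD.le
  have hR : ψ R = M := by
    rw [hψ, hk₁, hk₂]; simp only [sub_self, mul_zero, Real.exp_zero]
    have hD' := hD.ne'
    clear hk₁ hk₂ hep hem hD
    generalize Real.exp (μp * τ) = a at *
    generalize Real.exp (μm * τ) = b at *
    field_simp
    ring
  have hRτ : ψ (R + τ) = M := by
    rw [hψ, hk₁, hk₂, add_sub_cancel_left]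
    have hD' := hD.ne'
    clear hk₁ hk₂ hep hem hD
    generalize Real.exp (μp * τ) = a at *
    generalize Real.exp (μm * τ) = b at *
    field_simp
    ring
  have conv : ∀ x y z, x ≤ y → y ≤ z → (z - x) * ψ y ≤ (z - y) * ψ x + (y - x) * ψ z := by
    intro x y z hxy hyz
    have a := mul_le_mul_of_nonneg_left
      (aux_conv μm (x - R) (y - R) (z - R) (by linarith) (by linarith)) h1
    have b := mul_le_mul_of_nonneg_left
      (aux_conv μp (x - R) (y - R) (z - R) (by linarith) (by linarith)) h2
    rw [hψ, hψ, hψ]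
    linarith
  refine ⟨?_, hR, hRτ, ?_, ?_⟩
  · intro ξ
    have hd : deriv ψ ξ = k₁ * (Real.exp (μm * (ξ - R)) * μm)
        + k₂ * (Real.exp (μp * (ξ - R)) * μp) := by
      have hf : ψ = fun ξ => k₁ * Real.exp (μm * (ξ - R)) + k₂ * Real.exp (μp * (ξ - R)) :=
        funext hψ
      have g : ∀ μ : ℝ, HasDerivAt (fun ξ => Real.exp (μ * (ξ - R)))
          (Real.exp (μ * (ξ - R)) * μ) ξ := by
        intro μ
        have := (((hasDerivAt_id ξ).sub_const R).const_mul μ).exp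
        simpa using this
      rw [hf]
      exact (((g μm).const_mul k₁).add ((g μp).const_mul k₂)).deriv
    obtain ⟨im, em⟩ := aux_int k hexp μm R ξ
    obtain ⟨ip, ep⟩ := aux_int k hexp μp R ξ
    have hI : (∫ η, k (η - ξ) * ψ η)
        = k₁ * (Real.exp (μm * (ξ - R)) * ∫ η, Real.exp (μm * η) * k η)
        + k₂ * (Real.exp (μp * (ξ - R)) * ∫ η, Real.exp (μp * η) * k η) := by
      rw [← em, ← ep, ← integral_const_mul, ← integral_const_mul,
        ← integral_add (im.const_mul k₁) (ip.const_mul k₂)]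
      congr 1
      funext η
      rw [hψ]; ring
    rw [hd, hI, hψ]
    linear_combination k₁ * Real.exp (μm * (ξ - R)) * hrootm
      + k₂ * Real.exp (μp * (ξ - R)) * hrootp
  · intro ξ hξ
    have h := conv ξ R (R + τ) hξ (by linarith)
    rw [hR, hRτ] at h
    exact le_of_mul_le_mul_left (by linarith) hτ
  · intro ξ hξ
    have h := conv R (R + τ) ξ (by linarith) hξ
    rw [hR, hRτ] at h
    exact le_of_mul_le_mul_left (by linarith) hτ
end
end

section
/- (Tail behavior of traveling waves.) Assume (H1), (EXP) and (H2), let c≥0, and let μ₋<0<μ₊ be the two roots of cμ+∫_ℝ e^{μη} k(η) dη − 1 − q = 0. If Φ is a bounded positive traveling-wave profile, then limsup_{ξ→+∞} Φ(ξ) e^{−μ₋ξ} < ∞ and limsup_{ξ→−∞} Φ(ξ) e^{−μ₊ξ} < ∞. -/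
open MeasureTheory Real Set Filter Topology

noncomputable section

lemma shift_int (k : ℝ → ℝ) (hexp : EXPk k) (a ξ : ℝ) :
    Integrable (fun η => k (η - ξ) * Real.exp (a * η)) ∧
    (∫ η, k (η - ξ) * Real.exp (a * η)) =
      Real.exp (a * ξ) * ∫ η, Real.exp (a * η) * k η := by
  have h : (fun η => k (η - ξ) * Real.exp (a * η)) =
      fun η => Real.exp (a * ξ) * (fun z => Real.exp (a * z) * k z) (η - ξ) := by
    funext η
    have : a * η = a * ξ + a * (η - ξ) := by ring
    simp only
    rw [this, Real.exp_add]; ring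
  rw [h]
  refine ⟨((hexp a).comp_sub_right ξ).const_mul _, ?_⟩
  rw [integral_const_mul, integral_sub_right_eq_self (fun z => Real.exp (a * z) * k z) ξ]

lemma tail_key (k : ℝ → ℝ) (hk0 : ∀ z, 0 ≤ k z) (hk1 : (∫ z, k z) = 1) (hexp : EXPk k)
    (c q R a b M : ℝ) (hq : 0 < q) (ha : a < 0) (hb : 0 < b)
    (Ha : c * a + (∫ η, Real.exp (a * η) * k η) - 1 - q = 0)
    (Hb : c * b + (∫ η, Real.exp (b * η) * k η) - 1 - q = 0)
    (Φ : ℝ → ℝ) (hd : Differentiable ℝ Φ) (hpos : ∀ ξ, 0 < Φ ξ) (hM : ∀ ξ, Φ ξ ≤ M)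
    (heq : ∀ ξ, R ≤ ξ → c * deriv Φ ξ + ((∫ η, k (η - ξ) * Φ η) - Φ ξ) - q * Φ ξ = 0) :
    ∀ ξ, Φ ξ * Real.exp (-(a * ξ)) ≤ M * Real.exp (-(a * R)) := by
  have hki : Integrable k := by simpa using hexp 0
  have hM0 : 0 < M := (hpos 0).trans_le (hM 0)
  set ν := b / 2 with hν
  have hν0 : 0 < ν := by positivity
  set C := M * Real.exp (-(a * R)) with hC
  have Hν : c * ν + (∫ η, Real.exp (ν * η) * k η) - 1 - q < 0 := by
    have h1 : (∫ η, Real.exp (ν * η) * k η) ≤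
        ∫ η, ((1 / 2) * k η + (1 / 2) * (Real.exp (b * η) * k η)) := by
      refine integral_mono (hexp ν) ((hki.const_mul _).add ((hexp b).const_mul _)) ?_
      intro η
      have e : Real.exp (b * η) = Real.exp (ν * η) ^ 2 := by
        rw [← Real.exp_nat_mul]; congr 1; rw [hν]; push_cast; ring
      simp only
      rw [e]
      nlinarith [mul_nonneg (hk0 η) (sq_nonneg (Real.exp (ν * η) - 1))]
    rw [integral_add (hki.const_mul _) ((hexp b).const_mul _), integral_const_mul,
      integral_const_mul, hk1] at h1
    have : c * ν = c * b / 2 := by rw [hν]; ring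
    linarith
  have main : ∀ ε, 0 < ε → ∀ ξ, Φ ξ ≤ C * Real.exp (a * ξ) + ε * Real.exp (ν * ξ) := by
    intro ε hε
    set D : ℝ → ℝ := fun ξ => C * Real.exp (a * ξ) + ε * Real.exp (ν * ξ) - Φ ξ with hD
    suffices h : ∀ ξ, 0 ≤ D ξ by
      intro ξ; have := h ξ; simp only [hD] at this; linarith
    by_contra hcon
    push Not at hcon
    obtain ⟨ξ1, h1⟩ := hcon
    have hC0 : 0 < C := by positivity
    have hleft : ∀ ξ, ξ ≤ R → 0 ≤ D ξ := by
      intro ξ hξ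
      have e1 : M ≤ C * Real.exp (a * ξ) := by
        rw [hC, mul_assoc, ← Real.exp_add]
        have : (1:ℝ) ≤ Real.exp (-(a * R) + a * ξ) := by
          rw [Real.one_le_exp_iff]; nlinarith
        nlinarith
      have e2 : 0 < ε * Real.exp (ν * ξ) := by positivity
      have := hM ξ
      simp only [hD]; linarith
    have hright : ∃ N, ∀ ξ, N ≤ ξ → 0 ≤ D ξ := by
      have ht : Tendsto (fun ξ => ε * Real.exp (ν * ξ)) atTop atTop :=
        (Real.tendsto_exp_atTop.comp (tendsto_id.const_mul_atTop hν0)).const_mul_atTop hε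
      obtain ⟨N, hN⟩ := (eventually_atTop.1 (ht.eventually_ge_atTop M))
      refine ⟨N, fun ξ hξ => ?_⟩
      have e1 := hN ξ hξ
      have e2 : 0 < C * Real.exp (a * ξ) := by positivity
      have := hM ξ
      simp only [hD]; linarith
    obtain ⟨N, hN⟩ := hright
    have hR1 : R < ξ1 := by
      by_contra h; have := hleft ξ1 (not_lt.1 h); linarith
    have h1N : ξ1 < N := by
      by_contra h; have := hN ξ1 (not_lt.1 h); linarith
    have hder : ∀ ξ, HasDerivAt D (C * (a * Real.exp (a * ξ)) + ε * (ν * Real.exp (ν * ξ))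
        - deriv Φ ξ) ξ := by
      intro ξ
      have g : ∀ m : ℝ, HasDerivAt (fun x => Real.exp (m * x)) (m * Real.exp (m * ξ)) ξ := by
        intro m
        have := ((hasDerivAt_id ξ).const_mul m).exp
        simpa [mul_comm] using this
      exact (((g a).const_mul C).add ((g ν).const_mul ε)).sub (hd ξ).hasDerivAt
    have hDc : Continuous D := continuous_iff_continuousAt.2 fun ξ => (hder ξ).continuousAt
    obtain ⟨ξ0, h0mem, h0⟩ := (isCompact_Icc (a := R) (b := N)).exists_isMinOn
      ⟨ξ1, hR1.le, h1N.le⟩ hDc.continuousOn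
    have h01 : D ξ0 ≤ D ξ1 := h0 ⟨hR1.le, h1N.le⟩
    have hneg : D ξ0 < 0 := by linarith
    have hmin : ∀ ξ, D ξ0 ≤ D ξ := by
      intro ξ
      by_cases hl : ξ ≤ R
      · have := hleft ξ hl; linarith
      by_cases hr : N ≤ ξ
      · have := hN ξ hr; linarith
      exact h0 ⟨(not_le.1 hl).le, (not_le.1 hr).le⟩
    have hd0 : C * (a * Real.exp (a * ξ0)) + ε * (ν * Real.exp (ν * ξ0)) - deriv Φ ξ0 = 0 := by
      have hl : IsLocalMin D ξ0 := Eventually.of_forall hmin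
      exact hl.hasDerivAt_eq_zero (hder ξ0)
    obtain ⟨ia, ea⟩ := shift_int k hexp a ξ0
    obtain ⟨iν, eν⟩ := shift_int k hexp ν ξ0
    have iΦ : Integrable (fun η => k (η - ξ0) * Φ η) := by
      refine (hki.comp_sub_right ξ0).mul_bdd (c := M) hd.continuous.aestronglyMeasurable ?_
      refine Eventually.of_forall fun x => ?_
      rw [Real.norm_eq_abs, abs_of_pos (hpos x)]; exact hM x
    have iS : Integrable (fun η => C * (k (η - ξ0) * Real.exp (a * η))
        + ε * (k (η - ξ0) * Real.exp (ν * η))) := (ia.const_mul C).add (iν.const_mul ε)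
    have hint : D ξ0 ≤ C * (∫ η, k (η - ξ0) * Real.exp (a * η))
        + ε * (∫ η, k (η - ξ0) * Real.exp (ν * η)) - ∫ η, k (η - ξ0) * Φ η := by
      have s : (∫ η, k (η - ξ0) * D ξ0) = D ξ0 := by
        rw [integral_mul_const, integral_sub_right_eq_self k ξ0, hk1, one_mul]
      rw [← integral_const_mul, ← integral_const_mul,
        ← integral_add (ia.const_mul C) (iν.const_mul ε),
        ← integral_sub iS iΦ]
      rw [← s]
      refine integral_mono ((hki.comp_sub_right ξ0).mul_const _)
        (iS.sub iΦ) fun η => ?_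
      have := mul_le_mul_of_nonneg_left (hmin η) (hk0 (η - ξ0))
      refine this.trans (le_of_eq ?_)
      simp only [hD]; ring
    rw [ea, eν] at hint
    have hE := heq ξ0 h0mem.1
    have hdΦ : deriv Φ ξ0 = C * (a * Real.exp (a * ξ0)) + ε * (ν * Real.exp (ν * ξ0)) := by
      linarith
    rw [hdΦ] at hE
    have hDv : D ξ0 = C * Real.exp (a * ξ0) + ε * Real.exp (ν * ξ0) - Φ ξ0 := rfl
    have hΦv : Φ ξ0 = C * Real.exp (a * ξ0) + ε * Real.exp (ν * ξ0) - D ξ0 := by linarith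
    have p1 := mul_neg_of_pos_of_neg (mul_pos hε (Real.exp_pos (ν * ξ0))) Hν
    have p2 := congrArg (fun t => C * Real.exp (a * ξ0) * t) Ha
    have p3 := mul_neg_of_pos_of_neg hq hneg
    simp only [mul_zero] at p2
    rw [hΦv] at hE
    nlinarith
  intro ξ
  have h2 : Φ ξ ≤ C * Real.exp (a * ξ) := by
    refine le_of_forall_pos_le_add fun δ hδ => ?_
    have := main (δ / Real.exp (ν * ξ)) (by positivity) ξ
    rwa [div_mul_cancel₀ _ (Real.exp_pos _).ne'] at this
  calc Φ ξ * Real.exp (-(a * ξ)) ≤ C * Real.exp (a * ξ) * Real.exp (-(a * ξ)) := by gcongr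
    _ = C := by rw [mul_assoc, ← Real.exp_add]; simp

/-- Tail behavior of traveling waves: `Φ(ξ)e^{-μ₋ξ}` is bounded above as
`ξ → +∞` and `Φ(ξ)e^{-μ₊ξ}` is bounded above as `ξ → -∞`
(i.e. the corresponding limsups are finite). -/
theorem tail_behavior_traveling_waves
    (k : ℝ → ℝ) (hk : H1 k) (hexp : EXPk k)
    (r q L L0 : ℝ) (χ : ℝ → ℝ) (hχ : IsH2chi r q L L0 χ)
    (c : ℝ) (hc : 0 ≤ c)
    (μm μp : ℝ) (hμm : μm < 0) (hμp : 0 < μp)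
    (hrootm : c * μm + (∫ η, Real.exp (μm * η) * k η) - 1 - q = 0)
    (hrootp : c * μp + (∫ η, Real.exp (μp * η) * k η) - 1 - q = 0)
    (Φ : ℝ → ℝ) (hΦ : IsTW c k (fH2 r q χ) Φ) :
    (IsBoundedUnder (· ≤ ·) atTop fun ξ => Φ ξ * Real.exp (-(μm * ξ))) ∧
    (IsBoundedUnder (· ≤ ·) atBot fun ξ => Φ ξ * Real.exp (-(μp * ξ))) := by
  obtain ⟨-, hk0, hks, hk1, -, -⟩ := hk
  obtain ⟨-, hq, hL, hL0, -, -, -, -, hχ0, -⟩ := hχ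
  obtain ⟨hC1, hpos, ⟨M, hM⟩, heq⟩ := hΦ
  have hd : Differentiable ℝ Φ := hC1.differentiable (by norm_num)
  have heq' : ∀ ξ, L + L0 ≤ |ξ| →
      c * deriv Φ ξ + ((∫ η, k (η - ξ) * Φ η) - Φ ξ) - q * Φ ξ = 0 := by
    intro ξ hξ
    have h := heq ξ
    simp only [fH2, hχ0 ξ hξ] at h
    linarith
  have refl : ∀ m : ℝ, (∫ η, Real.exp (-m * η) * k η) = ∫ η, Real.exp (m * η) * k η := by
    intro m
    rw [← integral_neg_eq_self (fun η => Real.exp (m * η) * k η)]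
    refine integral_congr_ae (Eventually.of_forall fun η => ?_)
    simp only [hks]
    congr 2; ring
  constructor
  · refine isBoundedUnder_of ⟨_, tail_key k hk0 hk1 hexp c q (L + L0) μm μp M hq hμm hμp
      hrootm hrootp Φ hd hpos hM fun ξ hξ => heq' ξ (hξ.trans (le_abs_self ξ))⟩
  · have key := tail_key k hk0 hk1 hexp (-c) q (L + L0) (-μp) (-μm) M hq (by linarith)
      (by linarith) (by rw [refl]; linarith) (by rw [refl]; linarith) (fun x => Φ (-x))
      (hd.comp differentiable_neg) (fun ξ => hpos _) (fun ξ => hM _) (by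
        intro ξ hξ
        have h := heq' (-ξ) (by rw [abs_neg]; exact hξ.trans (le_abs_self ξ))
        have e : (∫ η, k (η - ξ) * Φ (-η)) = ∫ η, k (η - -ξ) * Φ η := by
          rw [← integral_neg_eq_self (fun η => k (η - -ξ) * Φ η)]
          refine integral_congr_ae (Eventually.of_forall fun η => ?_)
          simp only
          rw [← hks (η - ξ)]
          congr 2; ring
        rw [deriv_comp_neg, e]
        linarith)
    refine isBoundedUnder_of ⟨M * Real.exp (-(-μp * (L + L0))), fun ξ => ?_⟩
    have := key (-ξ)
    simp only [neg_neg, neg_mul_neg] at this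
    exact this
end
end
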